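/- arXiv:1002.4222 — 4 statements merged into one kernel-verified Lean document; each statement's English description precedes it below -/
import Mathlib

section
/- There exists an absolute constant C3 > 0 such that the following holds. Let Φ be an M × N real matrix, let s ≥ 1, and suppose Φ satisfies the restricted isometry property of order 2s with constant δ_{2s} ≤ √2 − 1. Let x₀ ∈ ℝ^N be s-sparse, let ε ≥ 0, let e ∈ ℝ^M with ‖e‖₂ ≤ ε, and set y = Φ x₀ + e. Then every vector x̃ ∈ ℝ^N satisfying ‖Φ x̃ − y‖₂ ≤ ε and ‖x̃‖₁ ≤ ‖x₀‖₁ (in particular, every minimizer of ‖x‖₁ subject to ‖Φx − y‖₂ ≤ ε) obeys ‖x̃ − x₀‖₂ ≤ C3 · ε. -/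
/-- The `ℓ₁` norm of a finitely supported real vector. -/
noncomputable def l1 {ι : Type*} [Fintype ι] (x : ι → ℝ) : ℝ := ∑ i, |x i|

/-- The `ℓ₂` (Euclidean) norm of a finitely supported real vector. -/
noncomputable def l2 {ι : Type*} [Fintype ι] (x : ι → ℝ) : ℝ := Real.sqrt (∑ i, (x i) ^ 2)

/-- A vector is `k`-sparse if it has at most `k` nonzero entries. -/
def IsSparse {ι : Type*} [Fintype ι] (k : ℕ) (x : ι → ℝ) : Prop :=
  {i | x i ≠ 0}.ncard ≤ k

/-- `Φ` satisfies the restricted isometry property of order `k` with constant `δ`: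
`(1 − δ)‖x‖₂² ≤ ‖Φx‖₂² ≤ (1 + δ)‖x‖₂²` for all `k`-sparse `x`. -/
def RIP {M N : ℕ} (Φ : Matrix (Fin M) (Fin N) ℝ) (k : ℕ) (δ : ℝ) : Prop :=
  ∀ x : Fin N → ℝ, IsSparse k x →
    (1 - δ) * (∑ i, (x i) ^ 2) ≤ ∑ j, (Φ.mulVec x j) ^ 2 ∧
    ∑ j, (Φ.mulVec x j) ^ 2 ≤ (1 + δ) * (∑ i, (x i) ^ 2)

/-- `xs` is a best `s`-term approximation to `x`: it agrees with `x` on a set `Γ`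
of `s` largest-magnitude entries (of cardinality `min s N`) and vanishes elsewhere. -/
def IsBestApprox {ι : Type*} [Fintype ι] (s : ℕ) (x xs : ι → ℝ) : Prop :=
  ∃ Γ : Finset ι, Γ.card = min s (Fintype.card ι) ∧
    (∀ i ∈ Γ, xs i = x i) ∧ (∀ i ∉ Γ, xs i = 0) ∧
    ∀ i ∈ Γ, ∀ j ∉ Γ, |x j| ≤ |x i|

open Finset in
lemma aux_top {ι : Type*} [DecidableEq ι] (h : ι → ℝ) (k : ℕ) (S : Finset ι) :
    ∃ T ⊆ S, T.card ≤ k ∧ (∀ i ∈ T, ∀ j ∈ S \ T, |h j| ≤ |h i|) ∧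
      ((S \ T).Nonempty → T.card = k) := by
  induction k with
  | zero => exact ⟨∅, by simp, by simp, by simp, by simp⟩
  | succ k ih =>
    obtain ⟨T, hTS, hc, hd, he⟩ := ih
    by_cases hne : (S \ T).Nonempty
    · obtain ⟨m, hm, hmax⟩ := exists_max_image (S \ T) (fun i => |h i|) hne
      have hm' := mem_sdiff.1 hm
      refine ⟨insert m T, ?_, ?_, ?_, ?_⟩
      · intro i hi
        rcases mem_insert.1 hi with rfl | hi
        · exact hm'.1
        · exact hTS hi
      · rw [card_insert_of_notMem hm'.2]; omega
      · intro i hi j hj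
        have hj' : j ∈ S \ T := by
          simp only [mem_sdiff, mem_insert, not_or] at hj ⊢
          exact ⟨hj.1, hj.2.2⟩
        rcases mem_insert.1 hi with rfl | hi
        · exact hmax j hj'
        · exact hd i hi j hj'
      · intro _
        rw [card_insert_of_notMem hm'.2, he hne]
    · exact ⟨T, hTS, by omega, hd, fun h => absurd h hne⟩

lemma aux_top_bd {ι : Type*} [DecidableEq ι] (h : ι → ℝ) (s : ℕ) (hs : 1 ≤ s) (S : Finset ι) :
    ∃ T ⊆ S, T.card ≤ s ∧ (S.Nonempty → T.Nonempty) ∧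
      (∀ j ∈ S \ T, |h j| ≤ (∑ i ∈ T, |h i|) / s) := by
  obtain ⟨T, hTS, hc, hd, he⟩ := aux_top h s S
  have hs' : (0:ℝ) < s := by exact_mod_cast hs
  refine ⟨T, hTS, hc, ?_, ?_⟩
  · intro hS
    by_cases hne : (S \ T).Nonempty
    · apply Finset.card_pos.1; rw [he hne]; omega
    · rw [Finset.not_nonempty_iff_eq_empty, Finset.sdiff_eq_empty_iff_subset] at hne
      exact hS.mono hne
  · intro j hj
    rw [le_div_iff₀ hs']
    have := Finset.card_nsmul_le_sum T (fun i => |h i|) |h j| (fun i hi => hd i hi j hj)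
    rw [he ⟨j, hj⟩, nsmul_eq_mul] at this
    linarith

lemma aux_block {ι : Type*} [DecidableEq ι] (h : ι → ℝ) (s : ℕ) (hs : 1 ≤ s)
    (p : Finset ι → ℝ) (K : ℝ) (hK : 0 ≤ K)
    (hsub : ∀ A B, Disjoint A B → p (A ∪ B) ≤ p A + p B) (S₀ : Finset ι)
    (hp : ∀ A ⊆ S₀, A.card ≤ s → p A ≤ K * √(∑ i ∈ A, h i ^ 2)) :
    ∀ n : ℕ, ∀ S ⊆ S₀, S.card ≤ n → ∀ m : ℝ, 0 ≤ m → (∀ i ∈ S, |h i| ≤ m) →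
      p S ≤ K * (√s * m + (∑ i ∈ S, |h i|) / √s) := by
  have hs' : (0:ℝ) < s := by exact_mod_cast hs
  have hq : 0 < √(s:ℝ) := Real.sqrt_pos.2 hs'
  have hqq : √(s:ℝ) * √(s:ℝ) = s := Real.mul_self_sqrt hs'.le
  intro n
  induction n with
  | zero =>
    intro S hS hc m hm _
    have : S = ∅ := by simpa using hc
    subst this
    have := hp ∅ (by simp) (by simp)
    simp at this ⊢
    have h2 : 0 ≤ K * (√(s:ℝ) * m) := by positivity
    linarith
  | succ n ih =>
    intro S hS hc m hm hb
    rcases S.eq_empty_or_nonempty with rfl | hne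
    · exact ih ∅ hS (by simp) m hm hb
    obtain ⟨T, hTS, hTc, hTne, hTb⟩ := aux_top_bd h s hs S
    have hTpos := Finset.card_pos.2 (hTne hne)
    have hcard := Finset.card_sdiff_add_card_eq_card hTS
    have h1 := ih (S \ T) (Finset.sdiff_subset.trans hS) (by omega) _
      (by positivity) hTb
    have h2 := hp T (hTS.trans hS) hTc
    have h3 := hsub T (S \ T) Finset.disjoint_sdiff
    rw [Finset.union_sdiff_of_subset hTS] at h3
    have h4 : √(∑ i ∈ T, h i ^ 2) ≤ √s * m := by
      apply Real.sqrt_le_iff.2 ⟨by positivity, ?_⟩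
      have : ∑ i ∈ T, h i ^ 2 ≤ T.card • m ^ 2 := by
        apply Finset.sum_le_card_nsmul
        intro i hi
        exact sq_le_sq.2 ((hb i (hTS hi)).trans (le_abs_self m))
      rw [nsmul_eq_mul] at this
      have h5 : (T.card : ℝ) ≤ s := by exact_mod_cast hTc
      rw [mul_pow, Real.sq_sqrt hs'.le]
      nlinarith [sq_nonneg m]
    have h6 : ∑ i ∈ S, |h i| = ∑ i ∈ S \ T, |h i| + ∑ i ∈ T, |h i| :=
      (Finset.sum_sdiff hTS).symm
    have h7 : √(s:ℝ) * ((∑ i ∈ T, |h i|) / s) = (∑ i ∈ T, |h i|) / √s := by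
      field_simp
      rw [sq, hqq, mul_comm]
    rw [h7] at h1
    rw [h6, add_div]
    have h8 := mul_le_mul_of_nonneg_left h4 hK
    nlinarith

/-- restriction of a vector to a set -/
noncomputable def resv {N : ℕ} (h : Fin N → ℝ) (A : Finset (Fin N)) : Fin N → ℝ :=
  fun i => if i ∈ A then h i else 0

lemma resv_union {N : ℕ} (h : Fin N → ℝ) (A B : Finset (Fin N)) (hd : Disjoint A B) :
    resv h (A ∪ B) = resv h A + resv h B := by
  ext i
  have : i ∈ A → i ∉ B := fun hi => Finset.disjoint_left.1 hd hi
  simp only [resv, Finset.mem_union, Pi.add_apply]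
  by_cases h1 : i ∈ A <;> by_cases h2 : i ∈ B <;> simp_all

lemma resv_sq {N : ℕ} (h : Fin N → ℝ) (A : Finset (Fin N)) :
    ∑ i, resv h A i ^ 2 = ∑ i ∈ A, h i ^ 2 := by
  simp [resv, ite_pow, Finset.sum_ite_mem]

lemma sum_comb {N : ℕ} (h : Fin N → ℝ) (A B : Finset (Fin N)) (hd : Disjoint A B) (t : ℝ) :
    ∑ i, (resv h A + t • resv h B) i ^ 2 = ∑ i ∈ A, h i ^ 2 + t ^ 2 * ∑ i ∈ B, h i ^ 2 := by
  rw [← resv_sq h A, ← resv_sq h B, Finset.mul_sum, ← Finset.sum_add_distrib]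
  refine Finset.sum_congr rfl fun i _ => ?_
  have : i ∈ A → i ∉ B := fun hi => Finset.disjoint_left.1 hd hi
  simp only [resv, Pi.add_apply, Pi.smul_apply, smul_eq_mul]
  by_cases h1 : i ∈ A <;> by_cases h2 : i ∈ B <;> simp_all [mul_pow]

lemma sparse_comb {N : ℕ} (h : Fin N → ℝ) (A B : Finset (Fin N)) (s : ℕ)
    (hA : A.card ≤ s) (hB : B.card ≤ s) (t : ℝ) :
    IsSparse (2 * s) (resv h A + t • resv h B) := by
  unfold IsSparse
  have : {i | (resv h A + t • resv h B) i ≠ 0} ⊆ ((A ∪ B : Finset (Fin N)) : Set (Fin N)) := by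
    intro i hi
    by_contra hc
    simp at hc
    apply hi
    simp [resv, hc.1, hc.2]
  refine (Set.ncard_le_ncard this (Finset.finite_toSet _)).trans ?_
  rw [Set.ncard_coe_finset]
  have := Finset.card_union_le A B
  omega

lemma sum_sq_dot {M : ℕ} (f : Fin M → ℝ) : ∑ j, f j ^ 2 = f ⬝ᵥ f := by
  simp [dotProduct, sq]

open Matrix in
lemma aux_inner {M N s : ℕ} (Φ : Matrix (Fin M) (Fin N) ℝ) (δ : ℝ) (hδ : 0 ≤ δ)
    (hR : RIP Φ (2 * s) δ) (h : Fin N → ℝ) (A B : Finset (Fin N)) (hd : Disjoint A B)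
    (hA : A.card ≤ s) (hB : B.card ≤ s) :
    |(Φ *ᵥ resv h A) ⬝ᵥ (Φ *ᵥ resv h B)| ≤
      δ * √(∑ i ∈ A, h i ^ 2) * √(∑ i ∈ B, h i ^ 2) := by
  set U := ∑ i ∈ A, h i ^ 2 with hU
  set V := ∑ i ∈ B, h i ^ 2 with hV
  set P := (Φ *ᵥ resv h A) ⬝ᵥ (Φ *ᵥ resv h B) with hP
  have hU0 : 0 ≤ U := Finset.sum_nonneg fun _ _ => sq_nonneg _
  have hV0 : 0 ≤ V := Finset.sum_nonneg fun _ _ => sq_nonneg _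
  have key : ∀ t : ℝ, 0 ≤ (δ * V) * (t * t) + (-2 * P) * t + δ * U := by
    intro t
    have e : ∀ t : ℝ, ∑ j, ((Φ *ᵥ (resv h A + t • resv h B)) j) ^ 2 =
        (Φ *ᵥ resv h A) ⬝ᵥ (Φ *ᵥ resv h A) + 2 * t * P
          + t ^ 2 * ((Φ *ᵥ resv h B) ⬝ᵥ (Φ *ᵥ resv h B)) := by
      intro t
      rw [sum_sq_dot, mulVec_add, mulVec_smul]
      simp only [add_dotProduct, dotProduct_add, smul_dotProduct, dotProduct_smul, smul_eq_mul]
      rw [dotProduct_comm (Φ *ᵥ resv h B) (Φ *ᵥ resv h A), ← hP]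
      ring
    have h1 := (hR _ (sparse_comb h A B s hA hB t)).2
    have h2 := (hR _ (sparse_comb h A B s hA hB (-t))).1
    rw [e, sum_comb h A B hd] at h1 h2
    nlinarith
  have hdis := discrim_le_zero key
  unfold discrim at hdis
  apply abs_le_of_sq_le_sq
  · rw [mul_pow, mul_pow, Real.sq_sqrt hU0, Real.sq_sqrt hV0]
    nlinarith
  · positivity

lemma aux_final (δ a b r q ε : ℝ) (hδ : 0 ≤ δ) (hδ2 : δ ≤ Real.sqrt 2 - 1)
    (hr : 0 ≤ r) (hq : 0 ≤ q) (hε : 0 ≤ ε)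
    (hr2 : r ^ 2 = a ^ 2 + b ^ 2) (h1 : (1 - δ) * r ^ 2 ≤ q ^ 2) (h2 : q ^ 2 ≤ (1 + δ) * r ^ 2)
    (h3 : q ^ 2 ≤ q * (2 * ε) + δ * (a + b) * a) : r ≤ 50 * ε := by
  have h5 : Real.sqrt 2 ≤ 1.415 := Real.sqrt_le_iff.2 ⟨by norm_num, by norm_num⟩
  have hd : δ ≤ 0.415 := by linarith
  have hab : (a + b) * a ≤ 1.21 * r ^ 2 := by
    rw [hr2]; nlinarith [sq_nonneg (a - 2.4 * b), sq_nonneg b, sq_nonneg a]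
  have hqr : q ≤ 2 * r := by
    refine (sq_le_sq₀ (by positivity) (by positivity)).1 ?_
    nlinarith [sq_nonneg r]
  have h6 : δ * ((a + b) * a) ≤ 0.415 * (1.21 * r ^ 2) :=
    (mul_le_mul_of_nonneg_left hab hδ).trans (mul_le_mul_of_nonneg_right hd (by positivity))
  have h7 : q * (2 * ε) ≤ 2 * r * (2 * ε) := mul_le_mul_of_nonneg_right hqr (by positivity)
  have h8 : (0.585 : ℝ) * r ^ 2 ≤ (1 - δ) * r ^ 2 :=
    mul_le_mul_of_nonneg_right (by linarith) (by positivity)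
  by_contra hc
  push Not at hc
  have hr' : 0 < r := lt_of_le_of_lt (by positivity) hc
  nlinarith [mul_lt_mul_of_pos_left hc hr']

open Matrix in
lemma aux_main {M N s : ℕ} (Φ : Matrix (Fin M) (Fin N) ℝ) (hs : 1 ≤ s) (δ : ℝ) (hδ : 0 ≤ δ)
    (hδ2 : δ ≤ Real.sqrt 2 - 1) (hR : RIP Φ (2 * s) δ) (h : Fin N → ℝ) (T : Finset (Fin N))
    (hT : T.card ≤ s) (hcone : ∑ i ∈ Tᶜ, |h i| ≤ ∑ i ∈ T, |h i|) (ε : ℝ) (hε : 0 ≤ ε)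
    (hn : ∑ j, (Φ *ᵥ h) j ^ 2 ≤ (2 * ε) ^ 2) : l2 h ≤ 100 * ε := by
  have hs' : (0:ℝ) < s := by exact_mod_cast hs
  have hq : 0 < √(s:ℝ) := Real.sqrt_pos.2 hs'
  have hqq : √(s:ℝ) * √(s:ℝ) = s := Real.mul_self_sqrt hs'.le
  obtain ⟨T1, hT1, hT1c, -, hT1b⟩ := aux_top_bd h s hs Tᶜ
  set R := Tᶜ \ T1 with hRdef
  have nn : ∀ A : Finset (Fin N), 0 ≤ ∑ i ∈ A, h i ^ 2 :=
    fun A => Finset.sum_nonneg fun _ _ => sq_nonneg _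
  have dT1 : Disjoint T T1 := (disjoint_compl_right).mono_right hT1
  have dTR : Disjoint T R := (disjoint_compl_right).mono_right Finset.sdiff_subset
  have d1R : Disjoint T1 R := Finset.disjoint_sdiff
  have hun : (T ∪ T1) ∪ R = Finset.univ := by
    rw [Finset.union_assoc, hRdef, Finset.union_sdiff_of_subset hT1, Finset.union_compl]
  have dU : Disjoint (T ∪ T1) R := Finset.disjoint_union_left.2 ⟨dTR, d1R⟩
  set a := √(∑ i ∈ T, h i ^ 2) with ha
  set b := √(∑ i ∈ T1, h i ^ 2) with hb
  have ha0 : 0 ≤ a := Real.sqrt_nonneg _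
  have hb0 : 0 ≤ b := Real.sqrt_nonneg _
  have ha2 : a ^ 2 = ∑ i ∈ T, h i ^ 2 := Real.sq_sqrt (nn _)
  have hb2 : b ^ 2 = ∑ i ∈ T1, h i ^ 2 := Real.sq_sqrt (nn _)
  -- tail bound
  have tail : √s * ((∑ i ∈ T1, |h i|) / s) + (∑ i ∈ R, |h i|) / √s ≤ a := by
    have h7 : √(s:ℝ) * ((∑ i ∈ T1, |h i|) / s) = (∑ i ∈ T1, |h i|) / √s := by
      field_simp
      rw [sq, hqq, mul_comm]
    have h6 : ∑ i ∈ R, |h i| + ∑ i ∈ T1, |h i| = ∑ i ∈ Tᶜ, |h i| := Finset.sum_sdiff hT1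
    rw [h7, ← add_div, add_comm, h6, div_le_iff₀ hq]
    refine hcone.trans ?_
    have hcs := sq_sum_le_card_mul_sum_sq (s := T) (f := fun i => |h i|)
    simp only [sq_abs] at hcs
    refine (sq_le_sq₀ (by positivity) (by positivity)).1 ?_
    rw [mul_pow, ha2, sq √(s:ℝ), hqq]
    have : (T.card : ℝ) ≤ s := by exact_mod_cast hT
    nlinarith [nn T]
  have blk := fun (p : Finset (Fin N) → ℝ) (K : ℝ) (hK : 0 ≤ K) hsub hp =>
    (aux_block h s hs p K hK hsub R hp R.card R subset_rfl le_rfl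
      ((∑ i ∈ T1, |h i|) / s) (by positivity) hT1b).trans (mul_le_mul_of_nonneg_left tail hK)
  have hRn : √(∑ i ∈ R, h i ^ 2) ≤ 1 * a := by
    refine blk (fun A => √(∑ i ∈ A, h i ^ 2)) 1 zero_le_one ?_ ?_
    · intro A B hd
      rw [Finset.sum_union hd]
      refine Real.sqrt_le_iff.2 ⟨by positivity, ?_⟩
      have hA2 := Real.sq_sqrt (nn A)
      have hB2 := Real.sq_sqrt (nn B)
      have := mul_nonneg (Real.sqrt_nonneg (∑ i ∈ A, h i ^ 2)) (Real.sqrt_nonneg (∑ i ∈ B, h i ^ 2))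
      nlinarith
    · intro A _ _; simp
  have hin : |(Φ *ᵥ resv h T) ⬝ᵥ (Φ *ᵥ resv h R)| + |(Φ *ᵥ resv h T1) ⬝ᵥ (Φ *ᵥ resv h R)|
      ≤ (δ * (a + b)) * a := by
    refine blk (fun A => |(Φ *ᵥ resv h T) ⬝ᵥ (Φ *ᵥ resv h A)|
      + |(Φ *ᵥ resv h T1) ⬝ᵥ (Φ *ᵥ resv h A)|) (δ * (a + b)) (by positivity) ?_ ?_
    · intro A B hd
      rw [resv_union h A B hd, mulVec_add, dotProduct_add, dotProduct_add]
      have := abs_add_le ((Φ *ᵥ resv h T) ⬝ᵥ (Φ *ᵥ resv h A)) ((Φ *ᵥ resv h T) ⬝ᵥ (Φ *ᵥ resv h B))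
      have := abs_add_le ((Φ *ᵥ resv h T1) ⬝ᵥ (Φ *ᵥ resv h A)) ((Φ *ᵥ resv h T1) ⬝ᵥ (Φ *ᵥ resv h B))
      linarith
    · intro A hA hAc
      have h1 := aux_inner Φ δ hδ hR h T A (dTR.mono_right hA) hT hAc
      have h2 := aux_inner Φ δ hδ hR h T1 A (d1R.mono_right hA) hT1c hAc
      rw [← ha] at h1
      rw [← hb] at h2
      linarith
  set u := resv h (T ∪ T1) with hu
  have hu1 : u = resv h T + resv h T1 := resv_union h _ _ dT1
  have hhu : h = u + resv h R := by
    rw [hu, ← resv_union h _ _ dU, hun]; ext i; simp [resv]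
  set q := √(∑ j, (Φ *ᵥ u) j ^ 2) with hqdef
  have hq2 : q ^ 2 = ∑ j, (Φ *ᵥ u) j ^ 2 :=
    Real.sq_sqrt (Finset.sum_nonneg fun _ _ => sq_nonneg _)
  set r := √(∑ i ∈ T ∪ T1, h i ^ 2) with hr
  have hr2 : r ^ 2 = ∑ i ∈ T ∪ T1, h i ^ 2 := Real.sq_sqrt (nn _)
  have hr2' : r ^ 2 = a ^ 2 + b ^ 2 := by rw [hr2, ha2, hb2, Finset.sum_union dT1]
  have hsp : IsSparse (2 * s) u := by
    have := sparse_comb h T T1 s hT hT1c 1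
    rwa [one_smul, ← hu1] at this
  have hrip := hR u hsp
  rw [hu, resv_sq, ← hr2, ← hu, ← hq2] at hrip
  have h3 : q ^ 2 ≤ q * (2 * ε) + δ * (a + b) * a := by
    have e1 : q ^ 2 = (Φ *ᵥ u) ⬝ᵥ (Φ *ᵥ h) - ((Φ *ᵥ resv h T) ⬝ᵥ (Φ *ᵥ resv h R)
        + (Φ *ᵥ resv h T1) ⬝ᵥ (Φ *ᵥ resv h R)) := by
      rw [hq2, sum_sq_dot, ← add_dotProduct, ← mulVec_add, ← hu1, ← dotProduct_sub,
        ← mulVec_sub]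
      congr 2
      exact eq_sub_of_add_eq hhu.symm
    have e2 : (Φ *ᵥ u) ⬝ᵥ (Φ *ᵥ h) ≤ q * (2 * ε) := by
      refine (Real.sum_mul_le_sqrt_mul_sqrt _ _ _).trans ?_
      refine mul_le_mul_of_nonneg_left ?_ (Real.sqrt_nonneg _)
      exact Real.sqrt_le_iff.2 ⟨by positivity, hn⟩
    have := neg_abs_le ((Φ *ᵥ resv h T) ⬝ᵥ (Φ *ᵥ resv h R))
    have := neg_abs_le ((Φ *ᵥ resv h T1) ⬝ᵥ (Φ *ᵥ resv h R))
    linarith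
  have hfin := aux_final δ a b r q ε hδ hδ2 (Real.sqrt_nonneg _) (Real.sqrt_nonneg _) hε hr2'
    hrip.1 hrip.2 h3
  unfold l2
  apply Real.sqrt_le_iff.2 ⟨by positivity, ?_⟩
  rw [← hun, Finset.sum_union dU, ← hr2]
  have hR2 : ∑ i ∈ R, h i ^ 2 ≤ a ^ 2 := by
    rw [one_mul] at hRn
    exact (Real.sqrt_le_left ha0).1 hRn
  have hr0 : 0 ≤ r := Real.sqrt_nonneg _
  nlinarith [sq_nonneg b]

theorem stmt4 : ∃ C3 : ℝ, 0 < C3 ∧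
    ∀ (M N s : ℕ) (Φ : Matrix (Fin M) (Fin N) ℝ), 1 ≤ s →
    (∃ δ : ℝ, 0 ≤ δ ∧ δ ≤ Real.sqrt 2 - 1 ∧ RIP Φ (2 * s) δ) →
    ∀ (x₀ : Fin N → ℝ), IsSparse s x₀ →
    ∀ (ε : ℝ) (e : Fin M → ℝ), 0 ≤ ε → l2 e ≤ ε →
    ∀ xt : Fin N → ℝ,
      l2 (fun j => Φ.mulVec xt j - (Φ.mulVec x₀ j + e j)) ≤ ε →
      l1 xt ≤ l1 x₀ →
      l2 (xt - x₀) ≤ C3 * ε := by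
  refine ⟨100, by norm_num, ?_⟩
  rintro M N s Φ hs ⟨δ, hδ, hδ2, hR⟩ x₀ hx ε e hε he xt hxt hl
  classical
  set T : Finset (Fin N) := Finset.univ.filter (fun i => x₀ i ≠ 0) with hTdef
  refine aux_main Φ hs δ hδ hδ2 hR (xt - x₀) T ?_ ?_ ε hε ?_
  · unfold IsSparse at hx
    rw [← Set.ncard_coe_finset]
    simpa [hTdef] using hx
  · unfold l1 at hl
    rw [← Finset.sum_add_sum_compl T, ← Finset.sum_add_sum_compl T (fun i => |x₀ i|)] at hl
    have z : ∀ i ∈ Tᶜ, x₀ i = 0 := by intro i hi; simpa [hTdef] using hi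
    have h1 : ∑ i ∈ Tᶜ, |x₀ i| = 0 := Finset.sum_eq_zero fun i hi => by simp [z i hi]
    have h2 : ∑ i ∈ Tᶜ, |(xt - x₀) i| = ∑ i ∈ Tᶜ, |xt i| :=
      Finset.sum_congr rfl fun i hi => by simp [z i hi]
    have h3 : ∑ i ∈ T, |x₀ i| ≤ ∑ i ∈ T, |xt i| + ∑ i ∈ T, |(xt - x₀) i| := by
      rw [← Finset.sum_add_distrib]
      refine Finset.sum_le_sum fun i _ => ?_
      have := abs_sub_abs_le_abs_sub (x₀ i) (xt i)
      rw [abs_sub_comm] at this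
      simp only [Pi.sub_apply]
      linarith
    linarith
  · unfold l2 at he hxt
    have he' := (Real.sqrt_le_left hε).1 he
    have hx' := (Real.sqrt_le_left hε).1 hxt
    have : ∑ j, (Φ.mulVec (xt - x₀)) j ^ 2 ≤
        ∑ j, (2 * (Φ.mulVec xt j - (Φ.mulVec x₀ j + e j)) ^ 2 + 2 * e j ^ 2) := by
      refine Finset.sum_le_sum fun j _ => ?_
      rw [Matrix.mulVec_sub, Pi.sub_apply]
      nlinarith [sq_nonneg ((Φ.mulVec xt j - (Φ.mulVec x₀ j + e j)) - e j)]
    rw [Finset.sum_add_distrib, ← Finset.mul_sum, ← Finset.mul_sum] at this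
    nlinarith
end

section
/- There exists an absolute constant C4 > 0 such that the following holds. Let Φ be an M × N real matrix, let s ≥ 1, and suppose Φ satisfies the restricted isometry property of order 2s with constant δ_{2s} ≤ √2 − 1. Let x₀ ∈ ℝ^N be arbitrary, let ε ≥ 0, let e ∈ ℝ^M with ‖e‖₂ ≤ ε, and set y = Φ x₀ + e. Then every vector x̃ ∈ ℝ^N satisfying ‖Φ x̃ − y‖₂ ≤ ε and ‖x̃‖₁ ≤ ‖x₀‖₁ (in particular, every minimizer of ‖x‖₁ subject to ‖Φx − y‖₂ ≤ ε) obeys ‖x̃ − x₀‖₂ ≤ C4 ( ε + s^{−1/2} ‖x₀ − x_{0,s}‖₁ ), where x_{0,s} is the best s-term approximation to x₀. -/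
lemma le_of_sq_le_sq_aux {x y : ℝ} (hy : 0 ≤ y) (h : x ^ 2 ≤ y ^ 2) : x ≤ y :=
  (le_abs_self x).trans (abs_le_of_sq_le_sq h hy)

noncomputable def rst {N : ℕ} (h : Fin N → ℝ) (T : Finset (Fin N)) : Fin N → ℝ :=
  fun i => if i ∈ T then h i else 0

lemma l2_nonneg' {ι : Type*} [Fintype ι] (x : ι → ℝ) : 0 ≤ l2 x := Real.sqrt_nonneg _

lemma l2_sq' {ι : Type*} [Fintype ι] (x : ι → ℝ) : l2 x ^ 2 = ∑ i, x i ^ 2 :=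
  Real.sq_sqrt (Finset.sum_nonneg fun i _ => sq_nonneg _)

lemma l2_eq_norm {ι : Type*} [Fintype ι] (x : ι → ℝ) : l2 x = ‖WithLp.toLp 2 x‖ := by
  simp [l2, EuclideanSpace.norm_eq]

lemma l2_add_le {ι : Type*} [Fintype ι] (x y : ι → ℝ) : l2 (x + y) ≤ l2 x + l2 y := by
  simp only [l2_eq_norm, WithLp.toLp_add]
  exact norm_add_le _ _

lemma dot_le_l2 {ι : Type*} [Fintype ι] (x y : ι → ℝ) : |x ⬝ᵥ y| ≤ l2 x * l2 y := by
  refine abs_le_of_sq_le_sq ?_ (mul_nonneg (l2_nonneg' x) (l2_nonneg' y))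
  rw [mul_pow, l2_sq', l2_sq']
  exact Finset.sum_mul_sq_le_sq_mul_sq _ _ _

lemma rst_l2_sq {N : ℕ} (h : Fin N → ℝ) (T : Finset (Fin N)) :
    l2 (rst h T) ^ 2 = ∑ i ∈ T, h i ^ 2 := by
  rw [l2_sq']
  simp [rst, ite_pow]

lemma rst_split {N : ℕ} (h : Fin N → ℝ) (A B : Finset (Fin N)) (hB : B ⊆ A) :
    rst h A = rst h B + rst h (A \ B) := by
  ext i
  have := @hB i
  by_cases h1 : i ∈ A <;> by_cases h2 : i ∈ B <;> simp_all [rst]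

lemma exists_top {N : ℕ} (h : Fin N → ℝ) (s : ℕ) (S : Finset (Fin N)) :
    ∃ T ⊆ S, T.card = min s S.card ∧ ∀ i ∈ T, ∀ j ∈ S \ T, |h j| ≤ |h i| := by
  induction s with
  | zero => exact ⟨∅, by simp, by simp, by simp⟩
  | succ s ih =>
    obtain ⟨T, hT, hc, ht⟩ := ih
    by_cases hne : (S \ T).Nonempty
    · obtain ⟨m, hm, hmax⟩ := Finset.exists_max_image (S \ T) (fun i => |h i|) hne
      have hm' := Finset.mem_sdiff.1 hm
      refine ⟨insert m T, Finset.insert_subset hm'.1 hT, ?_, ?_⟩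
      · rw [Finset.card_insert_of_notMem hm'.2]
        have : T.card < S.card := Finset.card_lt_card ⟨hT, fun h => hm'.2 (h hm'.1)⟩
        omega
      · intro i hi j hj
        have hj' : j ∈ S \ T := by
          simp only [Finset.mem_sdiff, Finset.mem_insert] at hj ⊢; tauto
        rcases Finset.mem_insert.1 hi with rfl | hi
        · exact hmax j hj'
        · exact ht i hi j hj'
    · rw [Finset.not_nonempty_iff_eq_empty, Finset.sdiff_eq_empty_iff_subset] at hne
      obtain rfl := Finset.Subset.antisymm hT hne
      exact ⟨T, hT, by omega, by simp⟩

lemma block_bound {N : ℕ} (h : Fin N → ℝ) (s : ℕ) (hs : 1 ≤ s) (T T' : Finset (Fin N))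
    (hT : T.card = s) (hT' : T'.card ≤ s) (hh : ∀ i ∈ T, ∀ j ∈ T', |h j| ≤ |h i|) :
    l2 (rst h T') ≤ (Real.sqrt s)⁻¹ * ∑ i ∈ T, |h i| := by
  set L := ∑ i ∈ T, |h i| with hL
  have hL0 : 0 ≤ L := Finset.sum_nonneg fun i _ => abs_nonneg _
  have hs0 : (0:ℝ) < s := by exact_mod_cast hs
  refine le_of_sq_le_sq_aux (by positivity) ?_
  rw [rst_l2_sq, mul_pow, inv_pow, Real.sq_sqrt hs0.le]
  have key : ∀ j ∈ T', h j ^ 2 ≤ (L / s) ^ 2 := by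
    intro j hj
    rw [← sq_abs]
    apply pow_le_pow_left₀ (abs_nonneg _)
    rw [le_div_iff₀ hs0]
    have := Finset.card_nsmul_le_sum T (fun i => |h i|) (|h j|) (fun i hi => hh i hi j hj)
    rw [hT, nsmul_eq_mul] at this
    linarith
  calc ∑ i ∈ T', h i ^ 2 ≤ T'.card • (L / s) ^ 2 := Finset.sum_le_card_nsmul _ _ _ key
    _ ≤ s * (L / s) ^ 2 := by
      rw [nsmul_eq_mul]; gcongr
    _ = (s:ℝ)⁻¹ * L ^ 2 := by field_simp

lemma tail_bound {N : ℕ} (h : Fin N → ℝ) (s : ℕ) (hs : 1 ≤ s) (F : Finset (Fin N) → ℝ) (K : ℝ)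
    (hK : 0 ≤ K) (hF0 : F ∅ ≤ 0) (hF : ∀ A B, B ⊆ A → F A ≤ F B + F (A \ B)) (n : ℕ) :
    ∀ S T : Finset (Fin N), S.card ≤ n → T ⊆ S → T.card = min s S.card →
    (∀ i ∈ T, ∀ j ∈ S \ T, |h j| ≤ |h i|) →
    (∀ A ⊆ S \ T, A.card ≤ s → F A ≤ K * l2 (rst h A)) →
    F (S \ T) ≤ K * ((Real.sqrt s)⁻¹ * ∑ i ∈ S, |h i|) := by
  induction n with
  | zero =>
    intro S T hS hT _ _ _
    have : S = ∅ := by simpa using hS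
    subst this
    simpa using hF0
  | succ n ih =>
    intro S T hS hT hc htop hA
    by_cases hle : S.card ≤ s
    · have : T = S := Finset.eq_of_subset_of_card_le hT (by omega)
      subst this
      rw [Finset.sdiff_self]
      refine hF0.trans ?_
      positivity
    · obtain ⟨T', hT', hc', htop'⟩ := exists_top h s (S \ T)
      have hcs : (S \ T).card = S.card - T.card := Finset.card_sdiff_of_subset hT
      have h1 := ih (S \ T) T' (by omega) hT' hc' htop'
        (fun A hA1 hA2 => hA A (hA1.trans Finset.sdiff_subset) hA2)
      have h2 := hA T' hT' (by omega)
      have h3 := block_bound h s hs T T' (by omega) (by omega)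
        (fun i hi j hj => htop i hi j (hT' hj))
      have h4 := hF (S \ T) T' hT'
      rw [← Finset.sum_sdiff hT]
      have h5 := mul_le_mul_of_nonneg_left h3 hK
      linarith [mul_add K ((Real.sqrt s)⁻¹ * ∑ i ∈ S \ T, |h i|) ((Real.sqrt s)⁻¹ * ∑ i ∈ T, |h i|), mul_add (Real.sqrt s)⁻¹ (∑ i ∈ S \ T, |h i|) (∑ i ∈ T, |h i|), congrArg (K * ·) (mul_add (Real.sqrt s)⁻¹ (∑ i ∈ S \ T, |h i|) (∑ i ∈ T, |h i|))]

lemma comb_sq {N : ℕ} (h : Fin N → ℝ) (A B : Finset (Fin N)) (hd : Disjoint A B) (t : ℝ) :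
    ∑ i, (rst h A + t • rst h B) i ^ 2 = l2 (rst h A) ^ 2 + t ^ 2 * l2 (rst h B) ^ 2 := by
  rw [l2_sq', l2_sq', Finset.mul_sum, ← Finset.sum_add_distrib]
  refine Finset.sum_congr rfl fun i _ => ?_
  by_cases h1 : i ∈ A
  · have : i ∉ B := Finset.disjoint_left.1 hd h1
    simp [rst, h1, this]
  · simp [rst, h1, mul_pow]

lemma comb_sparse {N : ℕ} (h : Fin N → ℝ) (A B : Finset (Fin N)) (s : ℕ) (hA : A.card ≤ s)
    (hB : B.card ≤ s) (t : ℝ) : IsSparse (2 * s) (rst h A + t • rst h B) := by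
  unfold IsSparse
  have : {i | (rst h A + t • rst h B) i ≠ 0} ⊆ ((A ∪ B : Finset (Fin N)) : Set (Fin N)) := by
    intro i hi
    by_contra hc
    simp at hc
    simp [rst, hc] at hi
  refine (Set.ncard_le_ncard this (Finset.finite_toSet _)).trans ?_
  rw [Set.ncard_coe_finset]
  exact (Finset.card_union_le _ _).trans (by omega)

lemma near_orth {M N : ℕ} (Φ : Matrix (Fin M) (Fin N) ℝ) (s : ℕ) (δ : ℝ) (hδ : 0 ≤ δ)
    (hR : RIP Φ (2 * s) δ) (h : Fin N → ℝ) (A B : Finset (Fin N)) (hd : Disjoint A B)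
    (hA : A.card ≤ s) (hB : B.card ≤ s) :
    |Φ.mulVec (rst h A) ⬝ᵥ Φ.mulVec (rst h B)| ≤ δ * l2 (rst h A) * l2 (rst h B) := by
  set a := l2 (rst h A)
  set b := l2 (rst h B)
  set u := Φ.mulVec (rst h A)
  set v := Φ.mulVec (rst h B)
  have key : ∀ t : ℝ, 0 ≤ (δ * b ^ 2) * (t * t) + (-2 * (u ⬝ᵥ v)) * t + δ * a ^ 2 := by
    intro t
    have h1 := (hR _ (comb_sparse h A B s hA hB t)).2
    have h2 := (hR _ (comb_sparse h A B s hA hB (-t))).1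
    rw [comb_sq h A B hd] at h1 h2
    have e : ∀ t : ℝ, ∑ j, (Φ.mulVec (rst h A + t • rst h B) j) ^ 2
        = ∑ j, u j ^ 2 + 2 * t * (u ⬝ᵥ v) + t ^ 2 * ∑ j, v j ^ 2 := by
      intro t
      rw [Matrix.mulVec_add, Matrix.mulVec_smul, dotProduct, Finset.mul_sum, Finset.mul_sum,
        ← Finset.sum_add_distrib, ← Finset.sum_add_distrib]
      refine Finset.sum_congr rfl fun i _ => ?_
      simp only [Pi.add_apply, Pi.smul_apply, smul_eq_mul]
      ring
    rw [e] at h1 h2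
    nlinarith
  have hdisc := discrim_le_zero key
  refine abs_le_of_sq_le_sq ?_ (mul_nonneg (mul_nonneg hδ (l2_nonneg' _)) (l2_nonneg' _))
  unfold discrim at hdisc
  nlinarith

lemma arith_aux (a b ε σ : ℝ) (ha : 0 ≤ a) (hb : 0 ≤ b) (hε : 0 ≤ ε) (hσ : 0 ≤ σ)
    (hmain : 0.585 * (a ^ 2 + b ^ 2) ≤ (a + b) * (4 * ε) + 0.415 * ((a + b) * (a + 2 * σ))) :
    0.04 * (a + b) ≤ 4 * ε + σ := by
  by_contra hc
  push Not at hc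
  have hpos : 0 < a + b := by linarith
  have h1 := mul_lt_mul_of_pos_left hc hpos
  have h2 := mul_nonneg hpos.le hσ
  have h3 := sq_nonneg (0.4142 * a - b)
  have h4 := sq_nonneg (a - b)
  have h5 := sq_nonneg a
  have h6 := sq_nonneg b
  have h7 := mul_nonneg ha hb
  ring_nf at *
  linarith

theorem stmt5 : ∃ C4 : ℝ, 0 < C4 ∧
    ∀ (M N s : ℕ) (Φ : Matrix (Fin M) (Fin N) ℝ), 1 ≤ s →
    (∃ δ : ℝ, 0 ≤ δ ∧ δ ≤ Real.sqrt 2 - 1 ∧ RIP Φ (2 * s) δ) →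
    ∀ (x₀ : Fin N → ℝ) (ε : ℝ) (e : Fin M → ℝ), 0 ≤ ε → l2 e ≤ ε →
    ∀ xt : Fin N → ℝ,
      l2 (fun j => Φ.mulVec xt j - (Φ.mulVec x₀ j + e j)) ≤ ε →
      l1 xt ≤ l1 x₀ →
      ∀ x₀s : Fin N → ℝ, IsBestApprox s x₀ x₀s →
        l2 (xt - x₀) ≤ C4 * (ε + (Real.sqrt s)⁻¹ * l1 (x₀ - x₀s)) := by
  refine ⟨200, by norm_num, ?_⟩
  rintro M N s Φ hs ⟨δ, hδ0, hδ1, hR⟩ x₀ ε e hε he xt hxt hl1 x₀s ⟨Γ, hΓc, hΓ1, hΓ2, -⟩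
  have hδ : δ ≤ 0.415 := by
    have : Real.sqrt 2 ≤ 1.415 := Real.sqrt_le_iff.2 ⟨by norm_num, by norm_num⟩
    linarith
  have hs0 : (0:ℝ) < s := by exact_mod_cast hs
  have hΓs : Γ.card ≤ s := by omega
  obtain ⟨h, rfl⟩ : ∃ h, xt = x₀ + h := ⟨xt - x₀, by simp⟩
  rw [add_sub_cancel_left]
  set P := l1 (x₀ - x₀s) with hP
  have hP' : P = ∑ i ∈ Γᶜ, |x₀ i| := by
    rw [hP, l1, ← Finset.sum_add_sum_compl Γ]
    have : ∑ i ∈ Γ, |(x₀ - x₀s) i| = 0 :=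
      Finset.sum_eq_zero fun i hi => by simp [hΓ1 i hi]
    rw [this, zero_add]
    refine Finset.sum_congr rfl fun i hi => ?_
    simp [hΓ2 i (Finset.mem_compl.1 hi)]
  have hcone : ∑ i ∈ Γᶜ, |h i| ≤ ∑ i ∈ Γ, |h i| + 2 * P := by
    unfold l1 at hl1
    rw [← Finset.sum_add_sum_compl Γ, ← Finset.sum_add_sum_compl Γ (fun i => |x₀ i|), ← hP'] at hl1
    have h1 : ∑ i ∈ Γ, (|x₀ i| - |h i|) ≤ ∑ i ∈ Γ, |(x₀ + h) i| := by
      refine Finset.sum_le_sum fun i _ => ?_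
      have := abs_sub_abs_le_abs_sub (x₀ i) (-h i)
      simpa using this
    have h2 : ∑ i ∈ Γᶜ, (|h i| - |x₀ i|) ≤ ∑ i ∈ Γᶜ, |(x₀ + h) i| := by
      refine Finset.sum_le_sum fun i _ => ?_
      have := abs_sub_abs_le_abs_sub (h i) (-x₀ i)
      simpa [add_comm] using this
    rw [Finset.sum_sub_distrib] at h1 h2
    rw [← hP'] at h2
    linarith
  set a := l2 (rst h Γ) with ha
  have ha0 : 0 ≤ a := l2_nonneg' _
  set σ := (Real.sqrt s)⁻¹ * P with hσ
  have hP0 : 0 ≤ P := by rw [hP']; positivity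
  have hσ0 : 0 ≤ σ := by positivity
  have hΓl1 : (Real.sqrt s)⁻¹ * ∑ i ∈ Γ, |h i| ≤ a := by
    rw [inv_mul_le_iff₀ (by positivity)]
    refine le_of_sq_le_sq_aux (by positivity) ?_
    rw [mul_pow, ha, rst_l2_sq, Real.sq_sqrt hs0.le]
    have := sq_sum_le_card_mul_sum_sq (s := Γ) (f := fun i => |h i|)
    simp only [sq_abs] at this
    refine this.trans ?_
    have : (Γ.card : ℝ) ≤ s := by exact_mod_cast hΓs
    gcongr
  have htail : (Real.sqrt s)⁻¹ * ∑ i ∈ Γᶜ, |h i| ≤ a + 2 * σ := by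
    have := mul_le_mul_of_nonneg_left hcone (by positivity : 0 ≤ (Real.sqrt s)⁻¹)
    rw [mul_add] at this
    linarith
  obtain ⟨T, hT, hTc, htop⟩ := exists_top h s Γᶜ
  have hTs : T.card ≤ s := by omega
  have hdT : Disjoint Γ T := Finset.disjoint_left.2 fun i h1 h2 => Finset.mem_compl.1 (hT h2) h1
  set b := l2 (rst h T) with hb
  have hb0 : 0 ≤ b := l2_nonneg' _
  have r0 : rst h ∅ = 0 := by ext i; simp [rst]
  have hrest : l2 (rst h (Γᶜ \ T)) ≤ a + 2 * σ := by
    have := tail_bound h s hs (fun A => l2 (rst h A)) 1 (by norm_num) (by simp [r0, l2])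
      (fun A B hB => by
        show l2 (rst h A) ≤ _
        rw [rst_split h A B hB]; exact l2_add_le _ _) _ Γᶜ T le_rfl hT hTc htop
      (fun A _ _ => by simp)
    linarith
  set w := rst h Γ + rst h T with hw
  have hcross : |Φ.mulVec w ⬝ᵥ Φ.mulVec (rst h (Γᶜ \ T))| ≤ δ * (a + b) * (a + 2 * σ) := by
    have := tail_bound h s hs (fun A => |Φ.mulVec w ⬝ᵥ Φ.mulVec (rst h A)|) (δ * (a + b))
      (by positivity) (by simp [r0])
      (fun A B hB => by
        show |Φ.mulVec w ⬝ᵥ Φ.mulVec (rst h A)| ≤ _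
        rw [rst_split h A B hB, Matrix.mulVec_add Φ (rst h B), dotProduct_add]; exact abs_add_le _ _)
      _ Γᶜ T le_rfl hT hTc htop
      (fun A hA hAs => by
        have d1 : Disjoint Γ A := Finset.disjoint_left.2 fun i h1 h2 => by
          have := hA h2
          simp at this
          exact this.1 h1
        have d2 : Disjoint T A := Finset.disjoint_left.2 fun i h1 h2 => by
          have := hA h2
          simp at this
          exact this.2 h1
        have n1 := near_orth Φ s δ hδ0 hR h Γ A d1 hΓs hAs
        have n2 := near_orth Φ s δ hδ0 hR h T A d2 hTs hAs
        show |Φ.mulVec w ⬝ᵥ Φ.mulVec (rst h A)| ≤ _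
        rw [hw, Matrix.mulVec_add, add_dotProduct]
        refine (abs_add_le _ _).trans ?_
        linarith)
    exact this.trans (mul_le_mul_of_nonneg_left htail (by positivity))
  have hsplit : h = w + rst h (Γᶜ \ T) := by
    rw [hw, add_assoc, ← rst_split h Γᶜ T hT]
    ext i
    by_cases hi : i ∈ Γ <;> simp [rst, hi]
  have hΦh : l2 (Φ.mulVec h) ≤ 2 * ε := by
    have : Φ.mulVec h = (fun j => Φ.mulVec (x₀ + h) j - (Φ.mulVec x₀ j + e j)) + e := by
      ext j; simp [Matrix.mulVec_add]
    rw [this]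
    exact (l2_add_le _ _).trans (by linarith)
  have hw1 : w = rst h Γ + (1:ℝ) • rst h T := by simp [hw]
  have hrip := hR w (by rw [hw1]; exact comb_sparse h Γ T s hΓs hTs 1)
  have hwsq : ∑ i, w i ^ 2 = a ^ 2 + b ^ 2 := by
    rw [hw1, comb_sq h Γ T hdT]; ring
  rw [hwsq, ← l2_sq'] at hrip
  obtain ⟨hlo, hhi⟩ := hrip
  set q := l2 (Φ.mulVec w) with hq
  have hq0 : 0 ≤ q := l2_nonneg' _
  have hq2 : q ≤ 2 * (a + b) := by
    refine le_of_sq_le_sq_aux (by positivity) ?_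
    nlinarith [mul_nonneg ha0 hb0, sq_nonneg a, sq_nonneg b]
  have hqq : q ^ 2 = Φ.mulVec w ⬝ᵥ Φ.mulVec h - Φ.mulVec w ⬝ᵥ Φ.mulVec (rst h (Γᶜ \ T)) := by
    rw [← dotProduct_sub, ← Matrix.mulVec_sub]
    have : h - rst h (Γᶜ \ T) = w := by rw [sub_eq_iff_eq_add]; exact hsplit
    rw [this, hq, l2_sq', dotProduct]
    exact Finset.sum_congr rfl fun i _ => by ring
  have hd1 : Φ.mulVec w ⬝ᵥ Φ.mulVec h ≤ 2 * (a + b) * (2 * ε) :=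
    (le_abs_self _).trans ((dot_le_l2 _ _).trans
      (mul_le_mul hq2 hΦh (l2_nonneg' _) (by positivity)))
  have hd2 := (neg_le_abs _).trans hcross
  have hmain : 0.585 * (a ^ 2 + b ^ 2) ≤ (a + b) * (4 * ε) + 0.415 * ((a + b) * (a + 2 * σ)) := by
    have e1 : δ * ((a + b) * (a + 2 * σ)) ≤ 0.415 * ((a + b) * (a + 2 * σ)) :=
      mul_le_mul_of_nonneg_right hδ (by positivity)
    have e2 : 0.585 * (a ^ 2 + b ^ 2) ≤ (1 - δ) * (a ^ 2 + b ^ 2) :=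
      mul_le_mul_of_nonneg_right (by linarith) (by positivity)
    linarith
  have hab : 0.04 * (a + b) ≤ 4 * ε + σ := by
    exact arith_aux a b ε σ ha0 hb0 hε hσ0 hmain
  have hfin : l2 h ≤ (a + b) + (a + 2 * σ) := by
    have h1 : l2 (w + rst h (Γᶜ \ T)) ≤ l2 w + l2 (rst h (Γᶜ \ T)) := l2_add_le _ _
    have h2 : l2 w ≤ a + b := l2_add_le _ _
    rw [← hsplit] at h1
    linarith
  linarith
end

section
/- There exists an absolute constant C > 0 such that the following holds. Let Φ be an M × N real matrix, let s ≥ 1, and suppose Φ satisfies the restricted isometry property of order 2s with constant δ_{2s} ≤ √2 − 1. Let x₀ ∈ ℝ^N and ε ≥ 0. Then every vector d ∈ ℝ^N satisfying ‖x₀ + d‖₁ ≤ ‖x₀‖₁ and ‖Φ d‖₂ ≤ 2ε obeys ‖d‖₂ ≤ C ( ε + s^{−1/2} ‖x₀ − x_{0,s}‖₁ ), where x_{0,s} is the best s-term approximation to x₀. -/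
noncomputable def rs {N : ℕ} (h : Fin N → ℝ) (A : Finset (Fin N)) : Fin N → ℝ :=
  fun i => if i ∈ A then h i else 0

noncomputable def qn {N : ℕ} (h : Fin N → ℝ) (A : Finset (Fin N)) : ℝ :=
  Real.sqrt (∑ i ∈ A, (h i) ^ 2)

lemma qn_sq {N : ℕ} (h : Fin N → ℝ) (A : Finset (Fin N)) : qn h A ^ 2 = ∑ i ∈ A, (h i) ^ 2 :=
  Real.sq_sqrt (Finset.sum_nonneg fun i _ => sq_nonneg _)

lemma qn_nonneg {N : ℕ} (h : Fin N → ℝ) (A : Finset (Fin N)) : 0 ≤ qn h A := Real.sqrt_nonneg _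

lemma qn_union {N : ℕ} (h : Fin N → ℝ) (A B : Finset (Fin N)) (hd : Disjoint A B) :
    qn h (A ∪ B) ≤ qn h A + qn h B := by
  unfold qn
  rw [Finset.sum_union hd]
  exact Real.sqrt_le_iff.mpr ⟨by positivity, by
    have h1 := Real.sq_sqrt (Finset.sum_nonneg fun i (_ : i ∈ A) => sq_nonneg (h i))
    have h2 := Real.sq_sqrt (Finset.sum_nonneg fun i (_ : i ∈ B) => sq_nonneg (h i))
    have h3 := mul_nonneg (Real.sqrt_nonneg (∑ i ∈ A, h i ^ 2)) (Real.sqrt_nonneg (∑ i ∈ B, h i ^ 2))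
    rw [add_sq, h1, h2]; linarith⟩

lemma rs_union {N : ℕ} (h : Fin N → ℝ) (A B : Finset (Fin N)) (hd : Disjoint A B) :
    rs h (A ∪ B) = rs h A + rs h B := by
  funext i
  have : i ∈ A → i ∉ B := fun hi => Finset.disjoint_left.mp hd hi
  simp only [rs, Pi.add_apply, Finset.mem_union]
  by_cases h1 : i ∈ A <;> by_cases h2 : i ∈ B <;> simp_all

lemma top_exists {N : ℕ} (h : Fin N → ℝ) (S : Finset (Fin N)) (k : ℕ) (hk : k ≤ S.card) :
    ∃ T ⊆ S, T.card = k ∧ ∀ i ∈ T, ∀ j ∈ S \ T, |h j| ≤ |h i| := by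
  induction k with
  | zero => exact ⟨∅, by simp, by simp, by simp⟩
  | succ k ih =>
    obtain ⟨T, hTS, hc, hT⟩ := ih (by omega)
    have hne : (S \ T).Nonempty := by
      rw [← Finset.card_pos, Finset.card_sdiff_of_subset hTS]; omega
    obtain ⟨a, ha, hmax⟩ := Finset.exists_max_image (S \ T) (fun i => |h i|) hne
    have ha' := Finset.mem_sdiff.mp ha
    refine ⟨insert a T, ?_, ?_, ?_⟩
    · exact Finset.insert_subset ha'.1 hTS
    · rw [Finset.card_insert_of_notMem ha'.2, hc]
    · intro i hi j hj
      have hj' : j ∈ S \ T := by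
        simp only [Finset.mem_sdiff, Finset.mem_insert, not_or] at hj ⊢
        exact ⟨hj.1, hj.2.2⟩
      rcases Finset.mem_insert.mp hi with rfl | hi
      · exact hmax j hj'
      · exact hT i hi j hj'

lemma qn_le {N : ℕ} (h : Fin N → ℝ) (A : Finset (Fin N)) (s : ℕ) (hA : A.card ≤ s) (m : ℝ)
    (hm : 0 ≤ m) (hb : ∀ i ∈ A, |h i| ≤ m) : qn h A ≤ Real.sqrt s * m := by
  unfold qn
  rw [Real.sqrt_le_iff]
  refine ⟨by positivity, ?_⟩
  rw [mul_pow, Real.sq_sqrt (by positivity)]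
  calc ∑ i ∈ A, (h i) ^ 2 ≤ ∑ i ∈ A, m ^ 2 :=
        Finset.sum_le_sum fun i hi => sq_le_sq' (by linarith [abs_le.mp (hb i hi)])
          (by linarith [abs_le.mp (hb i hi)])
    _ = A.card * m ^ 2 := by simp
    _ ≤ s * m ^ 2 := by gcongr

lemma head_le {N : ℕ} (h : Fin N → ℝ) (T : Finset (Fin N)) (s : ℕ) (hs : 1 ≤ s) (hT : T.card = s)
    (m : ℝ) (hb : ∀ i ∈ T, m ≤ |h i|) :
    Real.sqrt s * m ≤ (Real.sqrt s)⁻¹ * ∑ i ∈ T, |h i| := by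
  have h1 : (s : ℝ) * m ≤ ∑ i ∈ T, |h i| := by
    have := Finset.card_nsmul_le_sum T (fun i => |h i|) m hb
    rw [hT, nsmul_eq_mul] at this; exact this
  have hs0 : 0 < Real.sqrt s := Real.sqrt_pos.mpr (by exact_mod_cast hs)
  rw [le_inv_mul_iff₀ hs0, ← mul_assoc, Real.mul_self_sqrt (by positivity)]
  exact h1

lemma tail_ind {N : ℕ} (h : Fin N → ℝ) (s : ℕ) (hs : 1 ≤ s) (R : Finset (Fin N))
    (F : Finset (Fin N) → ℝ) (K : ℝ) (hK : 0 ≤ K)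
    (hU : ∀ A B, Disjoint A B → F (A ∪ B) ≤ F A + F B)
    (hF : ∀ A ⊆ R, A.card ≤ s → F A ≤ K * qn h A) :
    ∀ n : ℕ, ∀ S ⊆ R, S.card ≤ n → ∀ m, 0 ≤ m → (∀ i ∈ S, |h i| ≤ m) →
      F S ≤ K * (Real.sqrt s * m + (Real.sqrt s)⁻¹ * ∑ i ∈ S, |h i|) := by
  have small : ∀ S ⊆ R, S.card ≤ s → ∀ m, 0 ≤ m → (∀ i ∈ S, |h i| ≤ m) →
      F S ≤ K * (Real.sqrt s * m + (Real.sqrt s)⁻¹ * ∑ i ∈ S, |h i|) := by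
    intro S hSR hc m hm hb
    refine (hF S hSR hc).trans (mul_le_mul_of_nonneg_left ?_ hK)
    have h1 := qn_le h S s hc m hm hb
    have h2 : 0 ≤ (Real.sqrt s)⁻¹ * ∑ i ∈ S, |h i| :=
      mul_nonneg (by positivity) (Finset.sum_nonneg fun i _ => abs_nonneg _)
    linarith
  intro n
  induction n with
  | zero => intro S hSR hc; exact small S hSR (by omega)
  | succ n ih =>
    intro S hSR hc m hm hb
    by_cases hcs : S.card ≤ s
    · exact small S hSR hcs m hm hb
    obtain ⟨T, hTS, hTc, hT⟩ := top_exists h S s (by omega)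
    have hTne : T.Nonempty := by rw [← Finset.card_pos]; omega
    obtain ⟨a, ha, hmin⟩ := Finset.exists_min_image T (fun i => |h i|) hTne
    have e1 := ih (S \ T) (Finset.sdiff_subset.trans hSR)
      (by rw [Finset.card_sdiff_of_subset hTS]; omega) |h a| (abs_nonneg _) (hT a ha)
    have e2 := head_le h T s hs hTc |h a| hmin
    have e3 := (hF T (hTS.trans hSR) hTc.le).trans (mul_le_mul_of_nonneg_left
      (qn_le h T s hTc.le m hm (fun i hi => hb i (hTS hi))) hK)
    have e4 := hU T (S \ T) Finset.disjoint_sdiff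
    rw [Finset.union_sdiff_of_subset hTS] at e4
    have e5 := Finset.sum_sdiff (f := fun i => |h i|) hTS
    have e6 := mul_le_mul_of_nonneg_left e2 hK
    rw [← e5]
    simp only [mul_add] at *
    linarith

/-- tail bound after removing the top block. -/
lemma tail_main {N : ℕ} (h : Fin N → ℝ) (s : ℕ) (hs : 1 ≤ s) (S : Finset (Fin N)) :
    ∃ T ⊆ S, T.card ≤ s ∧ ∀ (F : Finset (Fin N) → ℝ) (K : ℝ), 0 ≤ K →
    (∀ A B, Disjoint A B → F (A ∪ B) ≤ F A + F B) →
    (∀ A ⊆ S \ T, A.card ≤ s → F A ≤ K * qn h A) →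
    F (S \ T) ≤ K * ((Real.sqrt s)⁻¹ * ∑ i ∈ S, |h i|) := by
  by_cases hcs : S.card ≤ s
  · refine ⟨S, subset_rfl, hcs, ?_⟩
    intro F K hK hU hF
    have := hF (S \ S) subset_rfl (by simp)
    have h0 : qn h (S \ S) = 0 := by simp [qn]
    rw [h0, mul_zero] at this
    refine this.trans (mul_nonneg hK (mul_nonneg (by positivity)
      (Finset.sum_nonneg fun i _ => abs_nonneg _)))
  · obtain ⟨T, hTS, hTc, hT⟩ := top_exists h S s (by omega)
    refine ⟨T, hTS, hTc.le, ?_⟩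
    intro F K hK hU hF
    have hTne : T.Nonempty := by rw [← Finset.card_pos]; omega
    obtain ⟨a, ha, hmin⟩ := Finset.exists_min_image T (fun i => |h i|) hTne
    have e1 := tail_ind h s hs (S \ T) F K hK hU hF _ (S \ T) subset_rfl le_rfl |h a|
      (abs_nonneg _) (hT a ha)
    have e2 := head_le h T s hs hTc |h a| hmin
    have e5 := Finset.sum_sdiff (f := fun i => |h i|) hTS
    refine e1.trans (mul_le_mul_of_nonneg_left ?_ hK)
    rw [← e5, mul_add]
    linarith

lemma rip_set {M N s : ℕ} {Φ : Matrix (Fin M) (Fin N) ℝ} {δ : ℝ} (hR : RIP Φ (2 * s) δ)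
    (h : Fin N → ℝ) (A B : Finset (Fin N)) (hA : A.card ≤ s) (hB : B.card ≤ s)
    (hd : Disjoint A B) (t : ℝ) :
    (1 - δ) * (qn h A ^ 2 + t ^ 2 * qn h B ^ 2) ≤
      ∑ j, (Φ.mulVec (rs h A) j + t * Φ.mulVec (rs h B) j) ^ 2 ∧
    ∑ j, (Φ.mulVec (rs h A) j + t * Φ.mulVec (rs h B) j) ^ 2 ≤
      (1 + δ) * (qn h A ^ 2 + t ^ 2 * qn h B ^ 2) := by
  have hsp : IsSparse (2 * s) (rs h A + t • rs h B) := by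
    unfold IsSparse
    have : {i | (rs h A + t • rs h B) i ≠ 0} ⊆ ((A ∪ B : Finset (Fin N)) : Set (Fin N)) := by
      intro i hi
      by_contra hc
      simp only [Finset.coe_union, Set.mem_union, Finset.mem_coe, not_or] at hc
      exact hi (by simp [rs, hc.1, hc.2])
    refine (Set.ncard_le_ncard this (Finset.finite_toSet _)).trans ?_
    rw [Set.ncard_coe_finset]
    exact (Finset.card_union_le _ _).trans (by omega)
  have key := hR _ hsp
  have hsum : ∑ i, ((rs h A + t • rs h B) i) ^ 2 = qn h A ^ 2 + t ^ 2 * qn h B ^ 2 := by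
    rw [qn_sq, qn_sq, Finset.mul_sum, ← Finset.sum_filter_add_sum_filter_not Finset.univ (· ∈ A)]
    have e : ∀ i, ((rs h A + t • rs h B) i) ^ 2 =
        (if i ∈ A then h i ^ 2 else 0) + (if i ∈ B then t ^ 2 * h i ^ 2 else 0) := by
      intro i
      have : i ∈ A → i ∉ B := fun hi => Finset.disjoint_left.mp hd hi
      simp only [rs, Pi.add_apply, Pi.smul_apply, smul_eq_mul]
      by_cases h1 : i ∈ A <;> by_cases h2 : i ∈ B <;> simp_all [mul_pow]
    rw [Finset.sum_filter_add_sum_filter_not]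
    simp only [e, Finset.sum_add_distrib, Finset.sum_ite_mem, Finset.univ_inter]
  rw [hsum] at key
  simpa [Matrix.mulVec_add, Matrix.mulVec_smul] using key

lemma rip_inner {M N s : ℕ} {Φ : Matrix (Fin M) (Fin N) ℝ} {δ : ℝ} (hδ : 0 ≤ δ)
    (hR : RIP Φ (2 * s) δ)
    (h : Fin N → ℝ) (A B : Finset (Fin N)) (hA : A.card ≤ s) (hB : B.card ≤ s)
    (hd : Disjoint A B) :
    -∑ j, Φ.mulVec (rs h A) j * Φ.mulVec (rs h B) j ≤ δ * qn h A * qn h B := by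
  set p := ∑ j, Φ.mulVec (rs h A) j * Φ.mulVec (rs h B) j with hp
  have ex : ∀ t : ℝ, ∑ j, (Φ.mulVec (rs h A) j + t * Φ.mulVec (rs h B) j) ^ 2 =
      ∑ j, (Φ.mulVec (rs h A) j) ^ 2 + 2 * t * p + t ^ 2 * ∑ j, (Φ.mulVec (rs h B) j) ^ 2 := by
    intro t
    rw [hp, Finset.mul_sum, Finset.mul_sum, ← Finset.sum_add_distrib, ← Finset.sum_add_distrib]
    exact Finset.sum_congr rfl fun j _ => by ring
  have key : ∀ t : ℝ, 0 ≤ (δ * qn h B ^ 2) * (t * t) + (2 * p) * t + δ * qn h A ^ 2 := by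
    intro t
    have h1 := (rip_set hR h A B hA hB hd t).1
    have h2 := (rip_set hR h A B hA hB hd (-t)).2
    rw [ex] at h1 h2
    nlinarith
  have hdis := discrim_le_zero key
  unfold discrim at hdis
  have hn : 0 ≤ δ * qn h A * qn h B :=
    mul_nonneg (mul_nonneg hδ (qn_nonneg _ _)) (qn_nonneg _ _)
  have : p ^ 2 ≤ (δ * qn h A * qn h B) ^ 2 := by nlinarith
  linarith [(abs_le.mp (abs_le_of_sq_le_sq this hn)).1]

theorem stmt6 : ∃ C : ℝ, 0 < C ∧
    ∀ (M N s : ℕ) (Φ : Matrix (Fin M) (Fin N) ℝ), 1 ≤ s →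
    (∃ δ : ℝ, 0 ≤ δ ∧ δ ≤ Real.sqrt 2 - 1 ∧ RIP Φ (2 * s) δ) →
    ∀ (x₀ : Fin N → ℝ) (ε : ℝ), 0 ≤ ε →
    ∀ d : Fin N → ℝ,
      l1 (x₀ + d) ≤ l1 x₀ →
      l2 (Φ.mulVec d) ≤ 2 * ε →
      ∀ x₀s : Fin N → ℝ, IsBestApprox s x₀ x₀s →
        l2 d ≤ C * (ε + (Real.sqrt s)⁻¹ * l1 (x₀ - x₀s)) := by
  refine ⟨200, by norm_num, ?_⟩
  rintro M N s Φ hs ⟨δ, hδ0, hδ, hR⟩ x₀ ε hε d hcone hΦ x₀s ⟨Γ, hΓc, hΓ1, hΓ2, -⟩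
  have hδ' : δ ≤ 0.4143 := by
    have : Real.sqrt 2 ≤ 1.4143 := by
      rw [Real.sqrt_le_iff]; norm_num
    linarith
  have hΓs : Γ.card ≤ s := by omega
  have hs0 : 0 < Real.sqrt s := Real.sqrt_pos.mpr (by exact_mod_cast hs)
  obtain ⟨T, hTS, hTc, htail⟩ := tail_main d s hs Γᶜ
  set R := Γᶜ \ T with hRdef
  have dΓT : Disjoint Γ T := Finset.disjoint_left.mpr fun i hi hT =>
    Finset.mem_compl.mp (hTS hT) hi
  have dΓR : Disjoint Γ R := Finset.disjoint_left.mpr fun i hi hT =>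
    Finset.mem_compl.mp (Finset.mem_sdiff.mp hT).1 hi
  have dTR : Disjoint T R := Finset.disjoint_sdiff
  have hTR : T ∪ R = Γᶜ := Finset.union_sdiff_of_subset hTS
  have hall : Γ ∪ (T ∪ R) = Finset.univ := by rw [hTR]; exact Finset.union_compl Γ
  set Sg := (Real.sqrt s)⁻¹ * ∑ i ∈ Γᶜ, |d i| with hSg
  set e := (Real.sqrt s)⁻¹ * l1 (x₀ - x₀s) with he
  set a := qn d Γ with ha
  set b := qn d T with hb
  have ha0 : 0 ≤ a := qn_nonneg _ _
  have hb0 : 0 ≤ b := qn_nonneg _ _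
  have he0 : 0 ≤ e := mul_nonneg (by positivity) (Finset.sum_nonneg fun i _ => abs_nonneg _)
  have hSg0 : 0 ≤ Sg := mul_nonneg (by positivity) (Finset.sum_nonneg fun i _ => abs_nonneg _)
  -- cone
  have hl1 : l1 (x₀ - x₀s) = ∑ i ∈ Γᶜ, |x₀ i| := by
    unfold l1
    rw [← Finset.sum_add_sum_compl Γ]
    rw [Finset.sum_eq_zero (s := Γ) (fun i hi => by simp [hΓ1 i hi]), zero_add]
    exact Finset.sum_congr rfl fun i hi => by simp [hΓ2 i (Finset.mem_compl.mp hi)]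
  have hc1 : ∑ i ∈ Γᶜ, |d i| ≤ ∑ i ∈ Γ, |d i| + 2 * ∑ i ∈ Γᶜ, |x₀ i| := by
    unfold l1 at hcone
    rw [← Finset.sum_add_sum_compl Γ, ← Finset.sum_add_sum_compl Γ (fun i => |x₀ i|)] at hcone
    have e1 : ∑ i ∈ Γ, (|x₀ i| - |d i|) ≤ ∑ i ∈ Γ, |(x₀ + d) i| :=
      Finset.sum_le_sum fun i _ => by
        have := abs_sub_abs_le_abs_sub (x₀ i) (-d i)
        simpa using this
    have e2 : ∑ i ∈ Γᶜ, (|d i| - |x₀ i|) ≤ ∑ i ∈ Γᶜ, |(x₀ + d) i| :=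
      Finset.sum_le_sum fun i _ => by
        have := abs_sub_abs_le_abs_sub (d i) (-x₀ i)
        simpa [add_comm] using this
    rw [Finset.sum_sub_distrib] at e1 e2
    linarith
  have hc2 : ∑ i ∈ Γ, |d i| ≤ Real.sqrt s * a := by
    have := sq_sum_le_card_mul_sum_sq (s := Γ) (f := fun i => |d i|)
    simp only [sq_abs] at this
    rw [← qn_sq d Γ, ← ha] at this
    refine (sq_le_sq₀ (Finset.sum_nonneg fun i _ => abs_nonneg _) (by positivity)).mp ?_
    rw [mul_pow, Real.sq_sqrt (by positivity)]
    refine this.trans ?_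
    gcongr
  have hSgle : Sg ≤ a + 2 * e := by
    rw [hSg, he, hl1, inv_mul_le_iff₀ hs0]
    have : Real.sqrt s * (a + 2 * ((Real.sqrt s)⁻¹ * ∑ i ∈ Γᶜ, |x₀ i|)) =
      Real.sqrt s * a + 2 * ∑ i ∈ Γᶜ, |x₀ i| := by field_simp
    rw [this]; linarith
  -- tail bounds
  have t1 : qn d R ≤ Sg := by
    have := htail (qn d) 1 zero_le_one (qn_union d) (fun A _ _ => by rw [one_mul])
    rwa [one_mul] at this
  have tin : ∀ B : Finset (Fin N), B.card ≤ s → Disjoint B R →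
      -∑ j, Φ.mulVec (rs d B) j * Φ.mulVec (rs d R) j ≤ δ * qn d B * Sg := by
    intro B hBc hBR
    refine htail (fun A => -∑ j, Φ.mulVec (rs d B) j * Φ.mulVec (rs d A) j) (δ * qn d B)
      (mul_nonneg hδ0 (qn_nonneg _ _)) ?_ ?_
    · intro A A' hd
      simp only [rs_union d A A' hd, Matrix.mulVec_add, Pi.add_apply, mul_add,
        Finset.sum_add_distrib]
      linarith
    · intro A hA hAc
      exact rip_inner hδ0 hR d B A hBc hAc (Finset.disjoint_of_subset_right hA hBR)
  have p0 := tin Γ hΓs dΓR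
  have p1 := tin T hTc dTR
  have hr := rip_set hR d Γ T hΓs hTc dΓT 1
  simp only [one_mul, one_pow] at hr
  set y0 := Φ.mulVec (rs d Γ) with hy0
  set y1 := Φ.mulVec (rs d T) with hy1
  set yR := Φ.mulVec (rs d R) with hyR
  have hdd : Φ.mulVec d = y0 + (y1 + yR) := by
    have : d = rs d (Γ ∪ (T ∪ R)) := by rw [hall]; funext i; simp [rs]
    conv_lhs => rw [this]
    rw [rs_union _ _ _ (Finset.disjoint_union_right.mpr ⟨dΓT, dΓR⟩), rs_union _ _ _ dTR,
      Matrix.mulVec_add, Matrix.mulVec_add]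
  have hcs : ∑ j, (y0 j + y1 j) * Φ.mulVec d j ≤ 4 * ε * (a + b) := by
    have h1 := Real.sum_mul_le_sqrt_mul_sqrt Finset.univ (fun j => y0 j + y1 j) (Φ.mulVec d)
    have h2 : Real.sqrt (∑ j, (y0 j + y1 j) ^ 2) ≤ 2 * (a + b) := by
      rw [Real.sqrt_le_iff]
      refine ⟨by positivity, hr.2.trans ?_⟩
      nlinarith [mul_nonneg ha0 hb0, sq_nonneg a, sq_nonneg b]
    have h3 := mul_le_mul h2 hΦ (Real.sqrt_nonneg _) (by positivity)
    unfold l2 at h3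
    linarith
  have hid : ∑ j, (y0 j + y1 j) ^ 2 = ∑ j, (y0 j + y1 j) * Φ.mulVec d j
      + (-∑ j, y0 j * yR j) + (-∑ j, y1 j * yR j) := by
    rw [hdd, ← Finset.sum_neg_distrib, ← Finset.sum_neg_distrib, ← Finset.sum_add_distrib,
      ← Finset.sum_add_distrib]
    exact Finset.sum_congr rfl fun j _ => by simp only [Pi.add_apply]; ring
  have hmain : (1 - δ) * (a ^ 2 + b ^ 2) ≤ 4 * ε * (a + b) + δ * (a + b) * (a + 2 * e) := by
    have := mul_le_mul_of_nonneg_left hSgle (mul_nonneg hδ0 (add_nonneg ha0 hb0))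
    linarith [hr.1]
  have hm2 : 0.5857 * (a ^ 2 + b ^ 2) ≤ 4 * ε * (a + b) + 0.4143 * (a + b) * (a + 2 * e) := by
    have h1 : 0 ≤ (0.4143 - δ) * ((a + b) * (a + 2 * e) + (a ^ 2 + b ^ 2)) :=
      mul_nonneg (by linarith) (by positivity)
    linarith
  have hab : a + b ≤ 25 * (4 * ε + e) := by
    by_contra hc
    push Not at hc
    have hpos : 0 < a + b := lt_of_le_of_lt (by positivity) hc
    have h1 := mul_lt_mul_of_pos_left hc hpos
    nlinarith [sq_nonneg (a - 1.88 * b), sq_nonneg b, mul_nonneg he0 hpos.le]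
  have hfin : l2 d ≤ a + (b + qn d R) := by
    have h1 : l2 d = qn d (Γ ∪ (T ∪ R)) := by rw [hall]; rfl
    rw [h1]
    have h2 := qn_union d Γ (T ∪ R) (Finset.disjoint_union_right.mpr ⟨dΓT, dΓR⟩)
    have h3 := qn_union d T R dTR
    linarith
  linarith
end

section
/- Let α and c be real numbers with 0 ≤ α ≤ 1 and c ≥ 0, and let β ≥ 0 be a real number satisfying β ≤ α ( c + √(β + 1) ). Then β ≤ α ( c + 1/2 + √(c + 5/4) ). -/
theorem stmt11 (α c β : ℝ) (hα0 : 0 ≤ α) (hα1 : α ≤ 1) (hc : 0 ≤ c) (hβ : 0 ≤ β)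
    (h : β ≤ α * (c + Real.sqrt (β + 1))) :
    β ≤ α * (c + 1 / 2 + Real.sqrt (c + 5 / 4)) := by
  have hs : 0 ≤ Real.sqrt (β + 1) := Real.sqrt_nonneg _
  have hs2 : Real.sqrt (β + 1) ^ 2 = β + 1 := Real.sq_sqrt (by linarith)
  have h1 : β ≤ c + Real.sqrt (β + 1) :=
    h.trans (mul_le_of_le_one_left (by linarith) hα1)
  have h2 : Real.sqrt (β + 1) - 1 / 2 ≤ Real.sqrt (c + 5 / 4) :=
    Real.le_sqrt_of_sq_le (by nlinarith)
  exact h.trans (mul_le_mul_of_nonneg_left (by linarith) hα0)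
end
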